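/- Let Z be a random vector in ℝ^d with law N(0, (1/d)·I_d), independent of X, let f⁰ : Y × 𝒳 → ℝ be bounded measurable with oscillation osc(f⁰), and suppose there exist τ > 0 and C_τ < ∞ such that E_X[ (ρ(ψ_w(X))/√d)^{−τ} ] ≤ C_τ. Then for every ε₀ and λ with 0 ≤ ε₀ ≤ λ < 1 and every q ∈ (0,1): |R_λ(w) − R_{ε₀}(w)| ≤ 4·osc(f⁰)·( C_τ·λ^{qτ} + exp( −1/(10·λ^{2(1−q)}) ) ). -/

import Mathlib

open MeasureTheory Metric Real
open scoped RealInnerProductSpace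

noncomputable section

/-- Density of the Gaussian measure `N(0, σ²·I_d)` on `ℝ^d`. -/
def gaussDensity (d : ℕ) (σ : ℝ) (v : EuclideanSpace ℝ (Fin d)) : ℝ :=
  (2 * π * σ ^ 2) ^ (-(d : ℝ) / 2) * Real.exp (-‖v‖ ^ 2 / (2 * σ ^ 2))

/-- The Gaussian measure `N(0, σ²·I_d)` on `ℝ^d`. -/
def gaussMeasure (d : ℕ) (σ : ℝ) : Measure (EuclideanSpace ℝ (Fin d)) :=
  volume.withDensity fun v => ENNReal.ofReal (gaussDensity d σ v)

/-- Normal cone `F_y` of the finite set `Y` at the point `y`. -/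
def normalCone {d : ℕ} (Y : Finset (EuclideanSpace ℝ (Fin d)))
    (y : EuclideanSpace ℝ (Fin d)) : Set (EuclideanSpace ℝ (Fin d)) :=
  {θ | ∀ y' ∈ Y, ⟪y', θ⟫ ≤ ⟪y, θ⟫}

/-- Internal cone radius `ρ(θ)`. -/
def coneRadius {d : ℕ} (Y : Finset (EuclideanSpace ℝ (Fin d)))
    (θ : EuclideanSpace ℝ (Fin d)) : ℝ :=
  sSup {r : ℝ | 0 < r ∧ ∀ u ∈ closedBall (0 : EuclideanSpace ℝ (Fin d)) 1,
    ∃ y ∈ Y, θ ∈ normalCone Y y ∧ θ + r • u ∈ normalCone Y y}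

/-- Uniform probability measure on the closed Euclidean unit ball of `ℝ^d`. -/
def uniformBall (d : ℕ) : Measure (EuclideanSpace ℝ (Fin d)) :=
  (volume (closedBall (0 : EuclideanSpace ℝ (Fin d)) 1))⁻¹ •
    volume.restrict (closedBall (0 : EuclideanSpace ℝ (Fin d)) 1)

/-- `p_0(y|θ) = P[θ + ρ(θ)·U ∈ F_y]` for `U` uniform on the closed unit ball. -/
def p0 {d : ℕ} (Y : Finset (EuclideanSpace ℝ (Fin d)))
    (y θ : EuclideanSpace ℝ (Fin d)) : ℝ :=
  (uniformBall d {u | θ + coneRadius Y θ • u ∈ normalCone Y y}).toReal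

section ConeGeometry

variable {d : ℕ}

/-- Directions on which no two distinct points of `Y` tie. -/
def TieFree (Y : Finset (EuclideanSpace ℝ (Fin d))) (θ : EuclideanSpace ℝ (Fin d)) : Prop :=
  ∀ y ∈ Y, ∀ y' ∈ Y, y ≠ y' → ⟪y, θ⟫ ≠ ⟪y', θ⟫

/-- Directions `v` in which `y` is optimal among the maximizers of `⟪·, θ⟫` over `Y`. -/
def faceCone (Y : Finset (EuclideanSpace ℝ (Fin d))) (θ y : EuclideanSpace ℝ (Fin d)) :
    Set (EuclideanSpace ℝ (Fin d)) :=
  {v | θ ∈ normalCone Y y ∧ ∀ y' ∈ Y, θ ∈ normalCone Y y' → ⟪y', v⟫ ≤ ⟪y, v⟫}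

/-- The value of `a` at the lexicographic maximizer for `(θ, v)`. -/
def selection (Y : Finset (EuclideanSpace ℝ (Fin d))) (a : EuclideanSpace ℝ (Fin d) → ℝ)
    (θ v : EuclideanSpace ℝ (Fin d)) : ℝ :=
  ∑ y ∈ Y, (faceCone Y θ y).indicator (fun _ => a y) v

/-- The radii admissible in the definition of `coneRadius`. -/
def admissibleRadii (Y : Finset (EuclideanSpace ℝ (Fin d))) (θ : EuclideanSpace ℝ (Fin d)) :
    Set ℝ :=
  {r : ℝ | 0 < r ∧ ∀ u ∈ closedBall (0 : EuclideanSpace ℝ (Fin d)) 1,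
    ∃ y ∈ Y, θ ∈ normalCone Y y ∧ θ + r • u ∈ normalCone Y y}

variable {Y : Finset (EuclideanSpace ℝ (Fin d))} {a : EuclideanSpace ℝ (Fin d) → ℝ}
  {θ v w y : EuclideanSpace ℝ (Fin d)}

lemma faceCone_zero : faceCone Y 0 y = normalCone Y y := by
  ext v
  simp [faceCone, normalCone]

lemma selection_eq (hv : TieFree Y v) (hy : y ∈ Y) (hmem : v ∈ faceCone Y θ y) :
    selection Y a θ v = a y := by
  rw [selection, Finset.sum_eq_single y]
  · exact Set.indicator_of_mem hmem _
  · intro y' hy' hne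
    refine Set.indicator_of_notMem (fun h => ?_) _
    exact hv y' hy' y hy hne
      (le_antisymm (hmem.2 y' hy' h.1) (h.2 y hy hmem.1))
  · exact fun h => absurd hy h

lemma selection_smul {t : ℝ} (ht : 0 < t) : selection Y a θ (t • v) = selection Y a θ v := by
  refine Finset.sum_congr rfl fun y _ => ?_
  have : t • v ∈ faceCone Y θ y ↔ v ∈ faceCone Y θ y := by
    simp only [faceCone, Set.mem_ofPred_eq, inner_smul_right, mul_le_mul_iff_right₀ ht]
  by_cases h : v ∈ faceCone Y θ y
  · rw [Set.indicator_of_mem h, Set.indicator_of_mem (this.2 h)]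
  · rw [Set.indicator_of_notMem h, Set.indicator_of_notMem (mt this.1 h)]

lemma abs_selection_le {B : ℝ} (ha : ∀ y, |a y| ≤ B) : |selection Y a θ v| ≤ Y.card * B := by
  calc |selection Y a θ v| ≤ ∑ y ∈ Y, |(faceCone Y θ y).indicator (fun _ => a y) v| :=
        Finset.abs_sum_le_sum_abs _ _
    _ ≤ ∑ _y ∈ Y, B := by
        refine Finset.sum_le_sum fun y _ => ?_
        by_cases h : v ∈ faceCone Y θ y
        · simpa [h] using ha y
        · simpa [h] using (abs_nonneg _).trans (ha y)
    _ = Y.card * B := by simp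

lemma exists_mem_normalCone (hY : Y.Nonempty) (θ : EuclideanSpace ℝ (Fin d)) :
    ∃ y ∈ Y, θ ∈ normalCone Y y :=
  Y.exists_max_image (fun y => ⟪y, θ⟫) hY

lemma exists_mem_faceCone (hY : Y.Nonempty) (θ v : EuclideanSpace ℝ (Fin d)) :
    ∃ y ∈ Y, v ∈ faceCone Y θ y := by
  classical
  obtain ⟨y₀, hy₀, h₀⟩ := exists_mem_normalCone hY θ
  obtain ⟨y, hy, h⟩ := (Y.filter fun y => θ ∈ normalCone Y y).exists_max_image
    (fun y => ⟪y, v⟫) ⟨y₀, Finset.mem_filter.2 ⟨hy₀, h₀⟩⟩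
  rw [Finset.mem_filter] at hy
  exact ⟨y, hy.1, hy.2, fun y' hy' h' => h y' (Finset.mem_filter.2 ⟨hy', h'⟩)⟩

lemma exists_selection_eq (hY : Y.Nonempty) (hv : TieFree Y v) :
    ∃ y ∈ Y, selection Y a θ v = a y := by
  obtain ⟨y, hy, h⟩ := exists_mem_faceCone hY θ v
  exact ⟨y, hy, selection_eq hv hy h⟩

lemma isClosed_normalCone (Y : Finset (EuclideanSpace ℝ (Fin d)))
    (y : EuclideanSpace ℝ (Fin d)) : IsClosed (normalCone Y y) := by
  have : normalCone Y y = ⋂ y' ∈ Y, {θ | ⟪y', θ⟫ ≤ ⟪y, θ⟫} := by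
    ext; simp [normalCone]
  rw [this]
  exact isClosed_biInter fun y' _ => isClosed_le (by fun_prop) (by fun_prop)

lemma measurable_selection {α : Type*} [MeasurableSpace α] {θ v : α → EuclideanSpace ℝ (Fin d)}
    {a : EuclideanSpace ℝ (Fin d) → α → ℝ} (ha : ∀ y, Measurable (a y))
    (hθ : Measurable θ) (hv : Measurable v) :
    Measurable fun x => selection Y (fun y => a y x) (θ x) (v x) := by
  refine Finset.measurable_sum _ fun y _ => ?_
  have hN : ∀ y, MeasurableSet {x | θ x ∈ normalCone Y y} := fun y =>
    hθ (isClosed_normalCone Y y).measurableSet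
  have hs : MeasurableSet {x | v x ∈ faceCone Y (θ x) y} := by
    have : {x | v x ∈ faceCone Y (θ x) y} = {x | θ x ∈ normalCone Y y} ∩
        ⋂ y' ∈ Y, ({x | θ x ∈ normalCone Y y'}ᶜ ∪ {x | ⟪y', v x⟫ ≤ ⟪y, v x⟫}) := by
      ext x
      simp [faceCone, imp_iff_not_or]
    rw [this]
    refine (hN y).inter (Finset.measurableSet_biInter _ fun y' _ => (hN y').compl.union ?_)
    exact measurableSet_le (hv.const_inner) (hv.const_inner)
  exact (ha y).indicator hs

lemma mem_admissibleRadii_of_le {r s : ℝ} (hr : r ∈ admissibleRadii Y θ) (hs : 0 < s)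
    (hsr : s ≤ r) : s ∈ admissibleRadii Y θ := by
  refine ⟨hs, fun u hu => ?_⟩
  obtain ⟨y, hy, h1, h2⟩ := hr.2 ((s / r) • u) (by
    rw [mem_closedBall_zero_iff] at hu ⊢
    rw [norm_smul, Real.norm_of_nonneg (div_pos hs hr.1).le]
    exact mul_le_one₀ ((div_le_one hr.1).2 hsr) (norm_nonneg _) hu)
  refine ⟨y, hy, h1, ?_⟩
  rwa [smul_smul, mul_div_cancel₀ _ hr.1.ne'] at h2

lemma coneRadius_pos_iff : 0 < coneRadius Y θ ↔
    (admissibleRadii Y θ).Nonempty ∧ BddAbove (admissibleRadii Y θ) := by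
  change 0 < sSup (admissibleRadii Y θ) ↔ _
  constructor
  · intro h
    refine ⟨Set.nonempty_iff_ne_empty.2 fun h0 => ?_, by_contra fun h0 => ?_⟩
    · rw [h0, Real.sSup_empty] at h
      exact h.false
    · rw [Real.sSup_of_not_bddAbove h0] at h
      exact h.false
  · rintro ⟨⟨r, hr⟩, hb⟩
    exact hr.1.trans_le (le_csSup hb hr)

lemma mem_admissibleRadii_of_lt_coneRadius {r : ℝ} (hr : 0 < r) (h : r < coneRadius Y θ) :
    r ∈ admissibleRadii Y θ := by
  obtain ⟨s, hs, hrs⟩ := exists_lt_of_lt_csSup (coneRadius_pos_iff.1 (hr.trans h)).1 h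
  exact mem_admissibleRadii_of_le hs hr hrs.le

lemma selection_add_eq (hw : ‖w‖ < coneRadius Y θ) (hw0 : TieFree Y w)
    (hθw : TieFree Y (θ + w)) : selection Y a 0 (θ + w) = selection Y a θ w := by
  obtain ⟨r, hr1, hr2⟩ := exists_between hw
  have hr0 : 0 < r := (norm_nonneg w).trans_lt hr1
  obtain ⟨y, hy, h1, h2⟩ := (mem_admissibleRadii_of_lt_coneRadius hr0 hr2).2 (r⁻¹ • w) (by
    rw [mem_closedBall_zero_iff, norm_smul, norm_inv, Real.norm_of_nonneg hr0.le,
      inv_mul_le_one₀ hr0]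
    exact hr1.le)
  rw [smul_smul, mul_inv_cancel₀ hr0.ne', one_smul] at h2
  rw [selection_eq hθw hy (by rwa [faceCone_zero]), selection_eq hw0 hy]
  refine ⟨h1, fun y' hy' h' => ?_⟩
  have e1 := h2 y' hy'
  rw [inner_add_right, inner_add_right] at e1
  linarith [h' y hy]

lemma exists_ne_of_coneRadius_pos (hY : Y.Nonempty) (h : 0 < coneRadius Y θ) :
    ∃ y ∈ Y, ∃ y' ∈ Y, y ≠ y' := by
  by_contra! hne
  obtain ⟨B, hB⟩ := (coneRadius_pos_iff.1 h).2
  obtain ⟨y, hy⟩ := hY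
  have hall : ∀ θ, θ ∈ normalCone Y y := fun θ y' hy' => by rw [hne y' hy' y hy]
  have : max 1 (B + 1) ∈ admissibleRadii Y θ :=
    ⟨by positivity, fun u _ => ⟨y, hy, hall _, hall _⟩⟩
  linarith [hB this, le_max_right 1 (B + 1)]

lemma bddAbove_admissibleRadii {y' : EuclideanSpace ℝ (Fin d)} (hθ : TieFree Y θ) (hy : y ∈ Y)
    (hy' : y' ∈ Y) (hne : y' ≠ y) (hmem : θ ∈ normalCone Y y) :
    BddAbove (admissibleRadii Y θ) := by
  have hpos : 0 < ‖y' - y‖ := norm_pos_iff.2 (sub_ne_zero.2 hne)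
  refine ⟨-⟪y' - y, θ⟫ / ‖y' - y‖, fun r hr => ?_⟩
  obtain ⟨z, hz, h1, h2⟩ := hr.2 (‖y' - y‖⁻¹ • (y' - y)) (by
    rw [mem_closedBall_zero_iff, norm_smul, norm_inv, norm_norm, inv_mul_cancel₀ hpos.ne'])
  have hzy : z = y := by
    by_contra h
    exact hθ z hz y hy h (le_antisymm (hmem z hz) (h1 y hy))
  subst hzy
  have h3 := h2 y' hy'
  rw [← sub_nonpos, ← inner_sub_left, inner_add_right, inner_smul_right, inner_smul_right,
    real_inner_self_eq_norm_sq] at h3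
  rw [le_div_iff₀ hpos]
  have : ‖y' - z‖⁻¹ * ‖y' - z‖ ^ 2 = ‖y' - z‖ := by field_simp
  rw [this] at h3
  linarith

lemma nonempty_admissibleRadii (hθ : TieFree Y θ) (hy : y ∈ Y) (hmem : θ ∈ normalCone Y y) :
    (admissibleRadii Y θ).Nonempty := by
  have hev : ∀ᶠ η in nhds θ, ∀ y' ∈ Y, ⟪y', η⟫ ≤ ⟪y, η⟫ := by
    rw [Finset.eventually_all]
    intro y' hy'
    rcases eq_or_ne y' y with rfl | hne
    · exact Filter.Eventually.of_forall fun _ => le_rfl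
    · have hlt : ⟪y', θ⟫ < ⟪y, θ⟫ := lt_of_le_of_ne (hmem y' hy') (hθ y' hy' y hy hne)
      have h1 : Continuous fun η => ⟪y', η⟫ := by fun_prop
      have h2 : Continuous fun η => ⟪y, η⟫ := by fun_prop
      exact (h1.continuousAt.eventually_lt h2.continuousAt hlt).mono fun _ h => h.le
  obtain ⟨r, hr, hball⟩ := Metric.nhds_basis_closedBall.eventually_iff.1 hev
  refine ⟨r, hr, fun u hu => ⟨y, hy, hmem, hball ?_⟩⟩
  rw [mem_closedBall_zero_iff] at hu
  rw [mem_closedBall, dist_self_add_left, norm_smul, Real.norm_of_nonneg hr.le]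
  exact mul_le_of_le_one_right hr.le hu

lemma coneRadius_pos_of_tieFree (h2 : ∃ y ∈ Y, ∃ y' ∈ Y, y ≠ y') (hθ : TieFree Y θ) :
    0 < coneRadius Y θ := by
  obtain ⟨y₁, h₁, y₂, h₂, hne⟩ := h2
  obtain ⟨y, hy, hmem⟩ := exists_mem_normalCone ⟨y₁, h₁⟩ θ
  refine coneRadius_pos_iff.2 ⟨nonempty_admissibleRadii hθ hy hmem, ?_⟩
  by_cases h : y₁ = y
  · exact bddAbove_admissibleRadii hθ hy h₂ (by rintro rfl; exact hne h) hmem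
  · exact bddAbove_admissibleRadii hθ hy h₁ h hmem

lemma selection_of_tieFree (hY : Y.Nonempty) (hθ : TieFree Y θ) (hv : TieFree Y v) :
    selection Y a θ v = selection Y a 0 θ := by
  obtain ⟨y, hy, hmem⟩ := exists_mem_normalCone hY θ
  rw [selection_eq hθ hy (by rwa [faceCone_zero]), selection_eq hv hy]
  refine ⟨hmem, fun y' hy' h' => ?_⟩
  rcases eq_or_ne y' y with rfl | hne
  · exact le_rfl
  · exact absurd (le_antisymm (hmem y' hy') (h' y hy)) (hθ y' hy' y hy hne)

lemma measurableSet_mem_admissibleRadii (Y : Finset (EuclideanSpace ℝ (Fin d))) (r : ℝ) :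
    MeasurableSet {θ | r ∈ admissibleRadii Y θ} := by
  classical
  have key : {θ | r ∈ admissibleRadii Y θ} = {_θ | 0 < r} ∩ ⋃ A ∈ Y.powerset,
      ((⋂ y ∈ A, normalCone Y y) ∩
        ⋂ u ∈ closedBall (0 : EuclideanSpace ℝ (Fin d)) 1,
          ⋃ y ∈ A, {θ | θ + r • u ∈ normalCone Y y}) := by
    ext θ
    simp only [Set.mem_inter_iff, Set.mem_iUnion, Set.mem_iInter, Set.mem_ofPred_eq,
      Finset.mem_powerset, exists_prop, admissibleRadii]
    refine and_congr_right fun _ => ⟨fun h => ?_, ?_⟩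
    · refine ⟨Y.filter fun y => θ ∈ normalCone Y y, Finset.filter_subset _ _,
        fun y hy => (Finset.mem_filter.1 hy).2, fun u hu => ?_⟩
      obtain ⟨y, hy, h1, h2⟩ := h u hu
      exact ⟨y, Finset.mem_filter.2 ⟨hy, h1⟩, h2⟩
    · rintro ⟨A, hAY, hA, h⟩ u hu
      obtain ⟨y, hy, h2⟩ := h u hu
      exact ⟨y, hAY hy, hA y hy, h2⟩
  rw [key]
  refine (MeasurableSet.const _).inter (Finset.measurableSet_biUnion _ fun A _ => ?_)
  refine MeasurableSet.inter
    (Finset.measurableSet_biInter _ fun y _ => (isClosed_normalCone Y y).measurableSet) ?_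
  refine (isClosed_biInter fun u _ => ?_).measurableSet
  refine A.finite_toSet.isClosed_biUnion fun y _ => ?_
  exact (isClosed_normalCone Y y).preimage (by fun_prop)

lemma measurable_coneRadius (Y : Finset (EuclideanSpace ℝ (Fin d))) :
    Measurable (coneRadius Y) := by
  refine measurable_of_Ioi fun c => ?_
  rcases lt_or_ge c 0 with hc | hc
  · have : coneRadius Y ⁻¹' Set.Ioi c = Set.univ := by
      refine Set.eq_univ_of_forall fun θ => ?_
      exact hc.trans_le (Real.sSup_nonneg fun r hr => hr.1.le)
    rw [this]
    exact MeasurableSet.univ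
  · have key : coneRadius Y ⁻¹' Set.Ioi c =
        (⋃ n : ℕ, {θ | ((n : ℝ) + 1) ∈ admissibleRadii Y θ}ᶜ) ∩
          ⋃ q : ℚ, {_θ | c < q} ∩ {θ | (q : ℝ) ∈ admissibleRadii Y θ} := by
      ext θ
      simp only [Set.mem_preimage, Set.mem_Ioi, Set.mem_inter_iff, Set.mem_iUnion,
        Set.mem_ofPred_eq, Set.mem_compl_iff]
      constructor
      · intro h
        have hpos := hc.trans_lt h
        refine ⟨?_, ?_⟩
        · obtain ⟨B, hB⟩ := (coneRadius_pos_iff.1 hpos).2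
          obtain ⟨n, hn⟩ := exists_nat_gt B
          exact ⟨n, fun hmem => by linarith [hB hmem]⟩
        · obtain ⟨q, hq1, hq2⟩ := exists_rat_btwn h
          exact ⟨q, hq1, mem_admissibleRadii_of_lt_coneRadius (hc.trans_lt hq1) hq2⟩
      · rintro ⟨⟨n, hn⟩, q, hcq, hq⟩
        refine hcq.trans_le (le_csSup ⟨n + 1, fun r hr => ?_⟩ hq)
        by_contra! hlt
        exact hn (mem_admissibleRadii_of_le hr (by positivity) hlt.le)
    rw [key]
    exact (MeasurableSet.iUnion fun n => (measurableSet_mem_admissibleRadii Y _).compl).inter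
      (MeasurableSet.iUnion fun q =>
        (MeasurableSet.const _).inter (measurableSet_mem_admissibleRadii Y _))

lemma ae_tieFree_add_smul (Y : Finset (EuclideanSpace ℝ (Fin d)))
    (θ : EuclideanSpace ℝ (Fin d)) {ε : ℝ} (hε : ε ≠ 0) :
    ∀ᵐ z, TieFree Y (θ + ε • z) := by
  have h0 : ∀ᵐ z : EuclideanSpace ℝ (Fin d), TieFree Y z := by
    simp only [TieFree]
    rw [Finset.eventually_all]
    intro y _
    rw [Finset.eventually_all]
    intro y' _
    rcases eq_or_ne y y' with rfl | hne
    · simp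
    · have hker : (ℝ ∙ (y - y'))ᗮ ≠ ⊤ := by
        rw [Ne, Submodule.orthogonal_eq_top_iff, Submodule.span_singleton_eq_bot]
        exact sub_ne_zero.2 hne
      have hnull := Measure.addHaar_submodule
        (volume : Measure (EuclideanSpace ℝ (Fin d))) _ hker
      filter_upwards [measure_eq_zero_iff_ae_notMem.1 hnull] with z hz _ heq
      refine hz ?_
      rw [SetLike.mem_coe, Submodule.mem_orthogonal_singleton_iff_inner_right, inner_sub_left,
        heq, sub_self]
  have hq : Measure.QuasiMeasurePreserving (fun z : EuclideanSpace ℝ (Fin d) => θ + ε • z)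
      volume volume :=
    (measurePreserving_add_left volume θ).quasiMeasurePreserving.comp
      (Measure.quasiMeasurePreserving_smul volume hε)
  exact hq.ae h0

end ConeGeometry

section Averages

variable {d : ℕ}

lemma gaussDensity_nonneg (d : ℕ) (σ : ℝ) (v : EuclideanSpace ℝ (Fin d)) :
    0 ≤ gaussDensity d σ v := by
  unfold gaussDensity
  positivity

lemma continuous_gaussDensity (d : ℕ) (σ : ℝ) : Continuous (gaussDensity d σ) := by
  unfold gaussDensity
  fun_prop

lemma integral_gaussDensity (d : ℕ) {σ : ℝ} (hσ : 0 < σ) :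
    ∫ v, gaussDensity d σ v = 1 := by
  have h := GaussianFourier.integral_rexp_neg_mul_sq_norm (V := EuclideanSpace ℝ (Fin d))
    (b := 1 / (2 * σ ^ 2)) (by positivity)
  have e : ∀ v : EuclideanSpace ℝ (Fin d),
      -‖v‖ ^ 2 / (2 * σ ^ 2) = -(1 / (2 * σ ^ 2)) * ‖v‖ ^ 2 := fun v => by ring
  have e2 : π / (1 / (2 * σ ^ 2)) = 2 * π * σ ^ 2 := by field_simp
  simp only [gaussDensity, integral_const_mul, e]
  rw [h, e2, finrank_euclideanSpace_fin, ← Real.rpow_add (by positivity), neg_div,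
    neg_add_cancel, Real.rpow_zero]

lemma isProbabilityMeasure_gaussMeasure (d : ℕ) {σ : ℝ} (hσ : 0 < σ) :
    IsProbabilityMeasure (gaussMeasure d σ) := by
  constructor
  have hint : Integrable (gaussDensity d σ) :=
    .of_integral_ne_zero (by rw [integral_gaussDensity d hσ]; exact one_ne_zero)
  rw [gaussMeasure, withDensity_apply _ MeasurableSet.univ, Measure.restrict_univ,
    ← ofReal_integral_eq_lintegral_ofReal hint (.of_forall (gaussDensity_nonneg d σ)),
    integral_gaussDensity d hσ, ENNReal.ofReal_one]

lemma gaussMeasure_absolutelyContinuous (d : ℕ) (σ : ℝ) : gaussMeasure d σ ≪ volume :=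
  withDensity_absolutelyContinuous _ _

lemma gaussDensity_eq_mul_exp (d : ℕ) {σ : ℝ} (hσ : 0 < σ) (v : EuclideanSpace ℝ (Fin d)) :
    gaussDensity d σ v =
      2 ^ ((d : ℝ) / 2) * Real.exp (-‖v‖ ^ 2 / (4 * σ ^ 2)) * gaussDensity d (√2 * σ) v := by
  have h1 : 2 * π * (√2 * σ) ^ 2 = 2 * (2 * π * σ ^ 2) := by
    rw [mul_pow, Real.sq_sqrt zero_le_two]; ring
  have h2 : -‖v‖ ^ 2 / (2 * σ ^ 2) =
      -‖v‖ ^ 2 / (4 * σ ^ 2) + -‖v‖ ^ 2 / (2 * (√2 * σ) ^ 2) := by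
    rw [mul_pow, Real.sq_sqrt zero_le_two]; field_simp; ring
  have h3 : (2 : ℝ) ^ ((d : ℝ) / 2) * 2 ^ (-(d : ℝ) / 2) = 1 := by
    rw [← Real.rpow_add zero_lt_two, neg_div, add_neg_cancel, Real.rpow_zero]
  rw [gaussDensity, gaussDensity, h1, h2, Real.exp_add,
    Real.mul_rpow zero_le_two (by positivity)]
  linear_combination -(2 * π * σ ^ 2) ^ (-(d : ℝ) / 2) *
    (Real.exp (-‖v‖ ^ 2 / (4 * σ ^ 2)) * Real.exp (-‖v‖ ^ 2 / (2 * (√2 * σ) ^ 2))) * h3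

lemma gaussMeasure_norm_ge_le (d : ℕ) {σ r : ℝ} (hσ : 0 < σ) (hr : 0 ≤ r) :
    (gaussMeasure d σ).real {v | r ≤ ‖v‖} ≤
      2 ^ ((d : ℝ) / 2) * Real.exp (-r ^ 2 / (4 * σ ^ 2)) := by
  have hs : MeasurableSet {v : EuclideanSpace ℝ (Fin d) | r ≤ ‖v‖} :=
    measurableSet_le measurable_const measurable_norm
  set K := 2 ^ ((d : ℝ) / 2) * Real.exp (-r ^ 2 / (4 * σ ^ 2)) with hK
  have := isProbabilityMeasure_gaussMeasure d (σ := √2 * σ) (by positivity)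
  refine ENNReal.toReal_le_of_le_ofReal (by positivity) ?_
  calc gaussMeasure d σ {v | r ≤ ‖v‖}
      = ∫⁻ v in {v | r ≤ ‖v‖}, ENNReal.ofReal (gaussDensity d σ v) := withDensity_apply _ hs
    _ ≤ ∫⁻ v in {v | r ≤ ‖v‖},
          ENNReal.ofReal K * ENNReal.ofReal (gaussDensity d (√2 * σ) v) := by
        refine setLIntegral_mono' hs fun v hv => ?_
        rw [← ENNReal.ofReal_mul (by positivity), gaussDensity_eq_mul_exp d hσ]
        refine ENNReal.ofReal_le_ofReal
          (mul_le_mul_of_nonneg_right ?_ (gaussDensity_nonneg _ _ _))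
        have hv' : r ^ 2 ≤ ‖v‖ ^ 2 := pow_le_pow_left₀ hr hv 2
        rw [hK]
        gcongr
    _ = ENNReal.ofReal K * gaussMeasure d (√2 * σ) {v | r ≤ ‖v‖} := by
        rw [gaussMeasure, withDensity_apply _ hs, lintegral_const_mul]
        exact (continuous_gaussDensity _ _).measurable.ennreal_ofReal
    _ ≤ ENNReal.ofReal K * 1 := by gcongr; exact prob_le_one
    _ = ENNReal.ofReal K := mul_one _

lemma gaussMeasure_inv_sqrt_norm_ge_le (hd : 1 ≤ d) {s : ℝ} (hs : 1 ≤ s) :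
    (gaussMeasure d (√d)⁻¹).real {v | √d * s ≤ ‖v‖} ≤ 2 * Real.exp (-s ^ 2 / 10) := by
  have hd' : (1 : ℝ) ≤ d := by exact_mod_cast hd
  refine (gaussMeasure_norm_ge_le d (by positivity) (by positivity)).trans ?_
  have h1 : -(√d * s) ^ 2 / (4 * (√d)⁻¹ ^ 2) = -(d : ℝ) ^ 2 * s ^ 2 / 4 := by
    rw [inv_pow, mul_pow, Real.sq_sqrt (by positivity)]
    field_simp
  have h2 : (2 : ℝ) * Real.exp (-s ^ 2 / 10) = Real.exp (Real.log 2 + -s ^ 2 / 10) := by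
    rw [Real.exp_add, Real.exp_log zero_lt_two]
  rw [h1, h2, Real.rpow_def_of_pos zero_lt_two, ← Real.exp_add, Real.exp_le_exp]
  have hs2 : 1 ≤ s ^ 2 := one_le_pow₀ hs
  have h3 : 0 ≤ ((d : ℝ) ^ 2 / 4 - 1 / 10) * (s ^ 2 - 1) :=
    mul_nonneg (by nlinarith) (by linarith)
  have h4 := mul_le_mul_of_nonneg_right Real.log_two_lt_d9.le (by positivity : (0 : ℝ) ≤ d)
  nlinarith [Real.log_two_gt_d9, sq_nonneg ((d : ℝ) - 1)]

lemma exists_integral_homogeneous_mul_radial {E : Type*} [NormedAddCommGroup E]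
    [NormedSpace ℝ E] [FiniteDimensional ℝ E] [MeasurableSpace E] [BorelSpace E] [Nontrivial E]
    (μ : Measure E) [μ.IsAddHaarMeasure] {c : E → ℝ}
    (hc : ∀ t : ℝ, 0 < t → ∀ v, c (t • v) = c v) :
    ∃ K : ℝ, ∀ φ : ℝ → ℝ, ∫ v, c v * φ ‖v‖ ∂μ = K * ∫ v, φ ‖v‖ ∂μ := by
  have polar : ∀ (b : E → ℝ), (∀ t : ℝ, 0 < t → ∀ v, b (t • v) = b v) → ∀ φ : ℝ → ℝ,
      ∫ v, b v * φ ‖v‖ ∂μ = (∫ ω : sphere (0 : E) 1, b ω ∂μ.toSphere) *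
        ∫ r : Set.Ioi (0 : ℝ), φ r ∂(.volumeIoiPow (Module.finrank ℝ E - 1)) := by
    intro b hb φ
    calc ∫ v, b v * φ ‖v‖ ∂μ
        = ∫ v : ({(0)}ᶜ : Set E), b v * φ ‖v.1‖ ∂(μ.comap (↑)) := by
          rw [integral_subtype_comap (measurableSet_singleton _).compl
            fun v => b v * φ ‖v‖, restrict_compl_singleton]
      _ = ∫ p, b p.1 * φ p.2 ∂μ.toSphere.prod
            (.volumeIoiPow (Module.finrank ℝ E - 1)) := by
          rw [← μ.measurePreserving_homeomorphUnitSphereProd.integral_comp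
            (Homeomorph.measurableEmbedding _) (fun p => b p.1 * φ p.2)]
          refine integral_congr_ae (.of_forall fun v => ?_)
          have hv : 0 < ‖v.1‖ := norm_pos_iff.2 v.2
          simp only [homeomorphUnitSphereProd_apply_fst_coe,
            homeomorphUnitSphereProd_apply_snd_coe, hb _ (inv_pos.2 hv)]
      _ = _ := integral_prod_mul (fun ω : sphere (0 : E) 1 => b ω)
            (fun r : Set.Ioi (0 : ℝ) => φ r)
  refine ⟨(∫ ω : sphere (0 : E) 1, c ω ∂μ.toSphere) / μ.toSphere.real Set.univ, fun φ => ?_⟩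
  have hne : μ.toSphere.real Set.univ ≠ 0 :=
    (measureReal_ne_zero_iff).2 (Measure.measure_univ_ne_zero.2 μ.toSphere_ne_zero)
  have h1 := polar (fun _ => 1) (fun _ _ _ => rfl) φ
  simp only [one_mul, integral_const, smul_eq_mul, mul_one] at h1
  rw [polar c hc, h1]
  field_simp

lemma uniformBall_absolutelyContinuous (d : ℕ) : uniformBall d ≪ volume :=
  (Measure.smul_absolutelyContinuous).trans Measure.restrict_le_self.absolutelyContinuous

lemma isProbabilityMeasure_uniformBall (d : ℕ) : IsProbabilityMeasure (uniformBall d) := by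
  constructor
  rw [uniformBall, Measure.smul_apply, Measure.restrict_apply_univ, smul_eq_mul]
  exact ENNReal.inv_mul_cancel (measure_closedBall_pos _ _ one_pos).ne'
    measure_closedBall_lt_top.ne

lemma ae_uniformBall_norm_lt_one (hd : 1 ≤ d) : ∀ᵐ u ∂uniformBall d, ‖u‖ < 1 := by
  have : Nonempty (Fin d) := ⟨⟨0, hd⟩⟩
  have h1 : ∀ᵐ u ∂uniformBall d, u ∈ closedBall (0 : EuclideanSpace ℝ (Fin d)) 1 :=
    Measure.smul_absolutelyContinuous.ae_le (ae_restrict_mem measurableSet_closedBall)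
  have h2 : ∀ᵐ u ∂uniformBall d, u ∉ sphere (0 : EuclideanSpace ℝ (Fin d)) 1 :=
    (uniformBall_absolutelyContinuous d).ae_le
      (measure_eq_zero_iff_ae_notMem.1 (Measure.addHaar_sphere _ _ _))
  filter_upwards [h1, h2] with u hu1 hu2
  rw [mem_closedBall_zero_iff] at hu1
  rw [mem_sphere_zero_iff_norm] at hu2
  exact lt_of_le_of_ne hu1 hu2

lemma integral_gaussMeasure_eq_integral_uniformBall (hd : 1 ≤ d) {σ : ℝ} (hσ : 0 < σ)
    {c : EuclideanSpace ℝ (Fin d) → ℝ} (hc : ∀ t : ℝ, 0 < t → ∀ v, c (t • v) = c v) :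
    ∫ z, c z ∂gaussMeasure d σ = ∫ u, c u ∂uniformBall d := by
  have : Nonempty (Fin d) := ⟨⟨0, hd⟩⟩
  obtain ⟨K, hK⟩ := exists_integral_homogeneous_mul_radial
    (volume : Measure (EuclideanSpace ℝ (Fin d))) hc
  have h1 : ∫ z, c z ∂gaussMeasure d σ = K := by
    have := hK fun r => (2 * π * σ ^ 2) ^ (-(d : ℝ) / 2) * Real.exp (-r ^ 2 / (2 * σ ^ 2))
    change ∫ v, c v * gaussDensity d σ v = K * ∫ v, gaussDensity d σ v at this
    rw [integral_gaussDensity d hσ, mul_one] at this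
    rw [← this, gaussMeasure, integral_withDensity_eq_integral_toReal_smul
      (continuous_gaussDensity d σ).measurable.ennreal_ofReal (by simp)]
    simp only [ENNReal.toReal_ofReal (gaussDensity_nonneg d σ _), smul_eq_mul, mul_comm]
  have h2 : ∫ u, c u ∂uniformBall d = K := by
    have hB : ∀ g : EuclideanSpace ℝ (Fin d) → ℝ,
        ∫ v, g v * (Set.Iic (1 : ℝ)).indicator 1 ‖v‖ =
          ∫ v in closedBall (0 : EuclideanSpace ℝ (Fin d)) 1, g v := by
      intro g
      rw [← integral_indicator measurableSet_closedBall]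
      refine integral_congr_ae (.of_forall fun v => ?_)
      by_cases hv : ‖v‖ ≤ 1 <;> simp [Set.indicator, hv]
    have h := hK ((Set.Iic (1 : ℝ)).indicator 1)
    have h' := hB fun _ => 1
    simp only [one_mul, integral_const, smul_eq_mul, mul_one,
      measureReal_restrict_apply_univ] at h'
    rw [hB, h'] at h
    have hne : volume.real (closedBall (0 : EuclideanSpace ℝ (Fin d)) 1) ≠ 0 :=
      (measureReal_ne_zero_iff measure_closedBall_lt_top.ne).2
        (measure_closedBall_pos _ _ one_pos).ne'
    rw [uniformBall, integral_smul_measure, h, ENNReal.toReal_inv, smul_eq_mul]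
    change (volume.real _)⁻¹ * _ = _
    field_simp
  rw [h1, h2]

variable {Y : Finset (EuclideanSpace ℝ (Fin d))} {a : EuclideanSpace ℝ (Fin d) → ℝ}
  {θ : EuclideanSpace ℝ (Fin d)}

lemma sum_p0_mul_eq_integral (Y : Finset (EuclideanSpace ℝ (Fin d)))
    (a : EuclideanSpace ℝ (Fin d) → ℝ) (θ : EuclideanSpace ℝ (Fin d)) :
    ∑ y ∈ Y, p0 Y y θ * a y = ∫ u, selection Y a 0 (θ + coneRadius Y θ • u) ∂uniformBall d := by
  have := isProbabilityMeasure_uniformBall d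
  have hs : ∀ y, MeasurableSet {u | θ + coneRadius Y θ • u ∈ normalCone Y y} := fun y =>
    ((isClosed_normalCone Y y).preimage (by fun_prop)).measurableSet
  have he : ∀ y, (fun u => (faceCone Y 0 y).indicator (fun _ => a y) (θ + coneRadius Y θ • u)) =
      {u | θ + coneRadius Y θ • u ∈ normalCone Y y}.indicator fun _ => a y := by
    intro y
    rw [faceCone_zero]
    rfl
  simp only [selection]
  rw [integral_finsetSum]
  · refine Finset.sum_congr rfl fun y _ => ?_
    rw [he, integral_indicator_const _ (hs y)]
    rfl
  · intro y _
    rw [he]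
    exact (integrable_const _).indicator (hs y)

lemma ae_tieFree_of_absolutelyContinuous {μ : Measure (EuclideanSpace ℝ (Fin d))}
    (hμ : μ ≪ volume) (θ : EuclideanSpace ℝ (Fin d)) {ε : ℝ} (hε : ε ≠ 0) :
    ∀ᵐ z ∂μ, TieFree Y (θ + ε • z) :=
  hμ.ae_le (ae_tieFree_add_smul Y θ hε)

lemma sum_p0_mul_eq_integral_selection (hd : 1 ≤ d) (hθ : 0 < coneRadius Y θ) :
    ∑ y ∈ Y, p0 Y y θ * a y = ∫ u, selection Y a θ u ∂uniformBall d := by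
  rw [sum_p0_mul_eq_integral]
  refine integral_congr_ae ?_
  have hac := uniformBall_absolutelyContinuous d
  filter_upwards [ae_uniformBall_norm_lt_one hd,
    ae_tieFree_of_absolutelyContinuous (Y := Y) hac θ hθ.ne',
    ae_tieFree_of_absolutelyContinuous (Y := Y) hac 0 hθ.ne'] with u hu h1 h2
  rw [zero_add] at h2
  rw [selection_add_eq _ h2 h1, selection_smul hθ]
  rw [norm_smul, Real.norm_of_nonneg hθ.le]
  exact mul_lt_of_lt_one_right hθ hu

lemma sum_p0_mul_of_tieFree (hd : 1 ≤ d) (h2 : ∃ y ∈ Y, ∃ y' ∈ Y, y ≠ y')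
    (hθ : TieFree Y θ) : ∑ y ∈ Y, p0 Y y θ * a y = selection Y a 0 θ := by
  have := isProbabilityMeasure_uniformBall d
  have hY : Y.Nonempty := h2.imp fun _ h => h.1
  have hae : (fun u => selection Y a θ u) =ᵐ[uniformBall d] fun _ => selection Y a 0 θ := by
    filter_upwards [ae_tieFree_of_absolutelyContinuous (Y := Y)
      (uniformBall_absolutelyContinuous d) 0 one_ne_zero] with u hu
    rw [zero_add, one_smul] at hu
    exact selection_of_tieFree hY hθ hu
  rw [sum_p0_mul_eq_integral_selection hd (coneRadius_pos_of_tieFree h2 hθ),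
    integral_congr_ae hae]
  simp

end Averages

section Bias

variable {d : ℕ} {Y : Finset (EuclideanSpace ℝ (Fin d))}

/-- Expected score at `θ` under a Gaussian perturbation of scale `ε`. -/
def perturbedScore (Y : Finset (EuclideanSpace ℝ (Fin d))) (a : EuclideanSpace ℝ (Fin d) → ℝ)
    (ε : ℝ) (θ : EuclideanSpace ℝ (Fin d)) : ℝ :=
  ∫ z, (∑ y ∈ Y, p0 Y y (θ + ε • z) * a y) ∂(gaussMeasure d (√d)⁻¹)

lemma isProbabilityMeasure_gaussMeasure_inv_sqrt (hd : 1 ≤ d) :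
    IsProbabilityMeasure (gaussMeasure d (√d)⁻¹) := by
  have : (0 : ℝ) < d := by exact_mod_cast hd
  exact isProbabilityMeasure_gaussMeasure d (by positivity)

lemma perturbedScore_of_pos (hd : 1 ≤ d) (h2 : ∃ y ∈ Y, ∃ y' ∈ Y, y ≠ y')
    (a : EuclideanSpace ℝ (Fin d) → ℝ) {ε : ℝ} (hε : 0 < ε) (θ : EuclideanSpace ℝ (Fin d)) :
    perturbedScore Y a ε θ = ∫ z, selection Y a 0 (θ + ε • z) ∂(gaussMeasure d (√d)⁻¹) := by
  refine integral_congr_ae ?_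
  filter_upwards [ae_tieFree_of_absolutelyContinuous (Y := Y)
    (gaussMeasure_absolutelyContinuous d _) θ hε.ne'] with z hz
  exact sum_p0_mul_of_tieFree hd h2 hz

lemma perturbedScore_zero (hd : 1 ≤ d) (a : EuclideanSpace ℝ (Fin d) → ℝ)
    {θ : EuclideanSpace ℝ (Fin d)} (hθ : 0 < coneRadius Y θ) :
    perturbedScore Y a 0 θ = ∫ z, selection Y a θ z ∂(gaussMeasure d (√d)⁻¹) := by
  have hd' : (0 : ℝ) < d := by exact_mod_cast hd
  have := isProbabilityMeasure_gaussMeasure_inv_sqrt hd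
  rw [integral_gaussMeasure_eq_integral_uniformBall hd (by positivity)
    fun t ht v => selection_smul ht, ← sum_p0_mul_eq_integral_selection hd hθ]
  simp [perturbedScore]

lemma abs_perturbedScore_sub_zero_le (hd : 1 ≤ d) (h2 : ∃ y ∈ Y, ∃ y' ∈ Y, y ≠ y')
    {a : EuclideanSpace ℝ (Fin d) → ℝ} {B D : ℝ} (hB : ∀ y, |a y| ≤ B)
    (hD : ∀ y ∈ Y, ∀ y' ∈ Y, |a y - a y'| ≤ D) {θ : EuclideanSpace ℝ (Fin d)}
    (hθ : 0 < coneRadius Y θ) {ε r : ℝ} (hε : 0 ≤ ε) (hεr : ε ≤ r) :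
    |perturbedScore Y a ε θ - perturbedScore Y a 0 θ| ≤
      D * (gaussMeasure d (√d)⁻¹).real {z | coneRadius Y θ ≤ r * ‖z‖} := by
  have := isProbabilityMeasure_gaussMeasure_inv_sqrt hd
  have hY : Y.Nonempty := h2.imp fun _ h => h.1
  have hD0 : 0 ≤ D := by
    obtain ⟨y, hy⟩ := hY
    exact (abs_nonneg _).trans (hD y hy y hy)
  rcases hε.eq_or_lt with rfl | hε
  · rw [sub_self, abs_zero]
    positivity
  have hint : ∀ η ξ : EuclideanSpace ℝ (Fin d) → EuclideanSpace ℝ (Fin d), Measurable η →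
      Measurable ξ → Integrable (fun z => selection Y a (η z) (ξ z)) (gaussMeasure d (√d)⁻¹) :=
    fun η ξ hη hξ => .of_bound (measurable_selection (a := fun y _ => a y)
      (fun _ => measurable_const) hη hξ).aestronglyMeasurable (Y.card * B)
      (.of_forall fun z => abs_selection_le hB)
  have hs : MeasurableSet {z : EuclideanSpace ℝ (Fin d) | coneRadius Y θ ≤ r * ‖z‖} :=
    measurableSet_le measurable_const (by fun_prop)
  rw [perturbedScore_of_pos hd h2 a hε, perturbedScore_zero hd a hθ,
    ← integral_sub (hint (fun _ => 0) (fun z => θ + ε • z) measurable_const (by fun_prop))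
      (hint (fun _ => θ) (fun z => z) measurable_const measurable_id),
    ← Real.norm_eq_abs]
  refine (norm_integral_le_of_norm_le
    ((integrable_const (μ := gaussMeasure d (√d)⁻¹) D).indicator hs) ?_).trans_eq ?_
  · have hac := gaussMeasure_absolutelyContinuous d (√d)⁻¹
    filter_upwards [ae_tieFree_of_absolutelyContinuous (Y := Y) hac θ hε.ne',
      ae_tieFree_of_absolutelyContinuous (Y := Y) hac 0 hε.ne',
      ae_tieFree_of_absolutelyContinuous (Y := Y) hac 0 one_ne_zero] with z h1 h3 h4
    rw [zero_add] at h3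
    rw [zero_add, one_smul] at h4
    by_cases hz : coneRadius Y θ ≤ r * ‖z‖
    · rw [Set.indicator_of_mem (by exact hz)]
      obtain ⟨y, hy, e⟩ := exists_selection_eq (a := a) (θ := 0) hY h1
      obtain ⟨y', hy', e'⟩ := exists_selection_eq (a := a) (θ := θ) hY h4
      rw [e, e']
      exact hD y hy y' hy'
    · rw [Set.indicator_of_notMem (by exact hz), selection_add_eq _ h3 h1, selection_smul hε,
        sub_self, norm_zero]
      rw [norm_smul, Real.norm_of_nonneg hε.le]
      exact (mul_le_mul_of_nonneg_right hεr (norm_nonneg z)).trans_lt (not_le.1 hz)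
  · rw [integral_indicator_const _ hs, smul_eq_mul, mul_comm]

lemma gaussMeasure_coneRadius_le (hd : 1 ≤ d) (θ : EuclideanSpace ℝ (Fin d)) {r q : ℝ}
    (hr : 0 < r) (hr1 : r < 1) (hq1 : q < 1) :
    (gaussMeasure d (√d)⁻¹).real {z | coneRadius Y θ ≤ r * ‖z‖} ≤
      {η | coneRadius Y η / √d ≤ r ^ q}.indicator (fun _ => (1 : ℝ)) θ +
        2 * Real.exp (-1 / (10 * r ^ (2 * (1 - q)))) := by
  have := isProbabilityMeasure_gaussMeasure_inv_sqrt hd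
  have hd' : (0 : ℝ) < √d := Real.sqrt_pos.2 (by exact_mod_cast hd)
  by_cases h : coneRadius Y θ / √d ≤ r ^ q
  · rw [Set.indicator_of_mem (by exact h)]
    have : (0 : ℝ) ≤ 2 * Real.exp (-1 / (10 * r ^ (2 * (1 - q)))) := by positivity
    linarith [measureReal_le_one (μ := gaussMeasure d (√d)⁻¹)
      (s := {z | coneRadius Y θ ≤ r * ‖z‖})]
  · rw [Set.indicator_of_notMem (by exact h), zero_add]
    have hs : 1 ≤ r ^ (q - 1) :=
      Real.one_le_rpow_of_pos_of_le_one_of_nonpos hr hr1.le (by linarith)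
    have hexp : -1 / (10 * r ^ (2 * (1 - q))) = -(r ^ (q - 1)) ^ 2 / 10 := by
      rw [← Real.rpow_natCast, ← Real.rpow_mul hr.le,
        show (q - 1) * ((2 : ℕ) : ℝ) = -(2 * (1 - q)) by push_cast; ring, Real.rpow_neg hr.le]
      field_simp
    rw [hexp]
    refine (measureReal_mono fun z hz => ?_).trans (gaussMeasure_inv_sqrt_norm_ge_le hd hs)
    rw [Set.mem_ofPred_eq] at hz ⊢
    rw [not_le, lt_div_iff₀ hd'] at h
    have hrs : r * r ^ (q - 1) = r ^ q := by
      rw [Real.rpow_sub_one hr.ne']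
      field_simp
    have : r * (√d * r ^ (q - 1)) ≤ r * ‖z‖ := by
      calc r * (√d * r ^ (q - 1)) = r ^ q * √d := by rw [← hrs]; ring
        _ ≤ r * ‖z‖ := h.le.trans hz
    exact le_of_mul_le_mul_left this hr

lemma measurable_integral_selection {𝒳 : Type*} [MeasurableSpace 𝒳] (hd : 1 ≤ d)
    {f : EuclideanSpace ℝ (Fin d) → 𝒳 → ℝ} (hf : ∀ y, Measurable (f y))
    {η ξ : 𝒳 × EuclideanSpace ℝ (Fin d) → EuclideanSpace ℝ (Fin d)}
    (hη : Measurable η) (hξ : Measurable ξ) :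
    Measurable fun x => ∫ z, selection Y (fun y => f y x) (η (x, z)) (ξ (x, z))
      ∂(gaussMeasure d (√d)⁻¹) := by
  have := isProbabilityMeasure_gaussMeasure_inv_sqrt hd
  have h := (measurable_selection (Y := Y) (a := fun y (p : 𝒳 × _) => f y p.1)
    (fun y => (hf y).comp measurable_fst) hη hξ).stronglyMeasurable
  exact (h.integral_prod_right' (ν := gaussMeasure d (√d)⁻¹)).measurable

lemma integrable_perturbedScore {𝒳 : Type*} [MeasurableSpace 𝒳] {μ : Measure 𝒳}
    [IsFiniteMeasure μ] (hd : 1 ≤ d) (h2 : ∃ y ∈ Y, ∃ y' ∈ Y, y ≠ y')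
    {ψ : 𝒳 → EuclideanSpace ℝ (Fin d)} (hψ : Measurable ψ)
    {f : EuclideanSpace ℝ (Fin d) → 𝒳 → ℝ} (hf : ∀ y, Measurable (f y))
    {B : ℝ} (hB : ∀ y x, |f y x| ≤ B) (hpos : ∀ᵐ x ∂μ, 0 < coneRadius Y (ψ x))
    {ε : ℝ} (hε : 0 ≤ ε) :
    Integrable (fun x => perturbedScore Y (fun y => f y x) ε (ψ x)) μ := by
  have := isProbabilityMeasure_gaussMeasure_inv_sqrt hd
  have key : ∀ η ξ : 𝒳 × EuclideanSpace ℝ (Fin d) → EuclideanSpace ℝ (Fin d),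
      Measurable η → Measurable ξ → Integrable (fun x => ∫ z, selection Y (fun y => f y x)
        (η (x, z)) (ξ (x, z)) ∂(gaussMeasure d (√d)⁻¹)) μ := by
    intro η ξ hη hξ
    refine .of_bound (measurable_integral_selection hd hf hη hξ).aestronglyMeasurable
      (Y.card * B) (.of_forall fun x => ?_)
    refine (norm_integral_le_of_norm_le_const (C := Y.card * B)
      (.of_forall fun z => abs_selection_le fun y => hB y x)).trans_eq ?_
    simp
  rcases hε.eq_or_lt with rfl | hε
  · refine (key (fun p => ψ p.1) Prod.snd (by fun_prop) measurable_snd).congr ?_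
    filter_upwards [hpos] with x hx
    exact (perturbedScore_zero hd _ hx).symm
  · simp only [perturbedScore_of_pos hd h2 _ hε]
    exact key (fun _ => 0) (fun p => ψ p.1 + ε • p.2) measurable_const (by fun_prop)

section NegativeMoment

variable {𝒳 : Type*} [MeasurableSpace 𝒳] {μ : Measure 𝒳} {g : 𝒳 → ℝ} {τ C : ℝ}

lemma ae_pos_of_lintegral_rpow_neg_le (hg : Measurable g) (hτ : 0 < τ)
    (h : ∫⁻ x, ENNReal.ofReal (g x) ^ (-τ) ∂μ ≤ ENNReal.ofReal C) : ∀ᵐ x ∂μ, 0 < g x := by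
  filter_upwards [ae_lt_top (by fun_prop) (h.trans_lt ENNReal.ofReal_lt_top).ne] with x hx
  by_contra! hle
  rw [ENNReal.ofReal_of_nonpos hle, ENNReal.zero_rpow_of_neg (neg_lt_zero.2 hτ)] at hx
  exact hx.false

lemma nonneg_of_lintegral_rpow_neg_le [NeZero μ] (hg : Measurable g) (hτ : 0 < τ)
    (h : ∫⁻ x, ENNReal.ofReal (g x) ^ (-τ) ∂μ ≤ ENNReal.ofReal C) : 0 ≤ C := by
  by_contra! hC
  rw [ENNReal.ofReal_of_nonpos hC.le, nonpos_iff_eq_zero,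
    lintegral_eq_zero_iff (by fun_prop)] at h
  obtain ⟨x, hx⟩ := h.exists
  rw [Pi.zero_apply, ENNReal.rpow_eq_zero_iff] at hx
  rcases hx with hx | hx
  · linarith [hx.2]
  · exact ENNReal.ofReal_ne_top hx.1

lemma measureReal_le_mul_rpow_of_lintegral_rpow_neg_le (hg : Measurable g) (hτ : 0 < τ)
    (hC : 0 ≤ C) (h : ∫⁻ x, ENNReal.ofReal (g x) ^ (-τ) ∂μ ≤ ENNReal.ofReal C) {b : ℝ}
    (hb : 0 < b) : μ.real {x | g x ≤ b} ≤ C * b ^ τ := by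
  have h1 : ENNReal.ofReal (b ^ (-τ)) * μ {x | g x ≤ b} ≤ ENNReal.ofReal C := by
    rw [← ENNReal.ofReal_rpow_of_pos hb]
    refine (mul_le_mul_right (measure_mono fun x hx => ?_) _).trans
      ((mul_meas_ge_le_lintegral₀ (by fun_prop) _).trans h)
    rw [Set.mem_ofPred_eq] at hx ⊢
    rw [ENNReal.rpow_neg, ENNReal.rpow_neg, ENNReal.inv_le_inv]
    exact ENNReal.rpow_le_rpow (ENNReal.ofReal_le_ofReal hx) hτ.le
  have h2 := ENNReal.toReal_mono ENNReal.ofReal_ne_top h1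
  rw [ENNReal.toReal_mul, ENNReal.toReal_ofReal (by positivity), ENNReal.toReal_ofReal hC,
    Real.rpow_neg hb.le] at h2
  have h3 : 0 < b ^ τ := by positivity
  rwa [inv_mul_le_iff₀ h3, mul_comm] at h2

end NegativeMoment

end Bias

/-- Quantitative perturbation bias bound: with Gaussian perturbation `Z ~ N(0,(1/d)·I_d)`
independent of `X`, bounded `f⁰`, and the moment condition
`E_X[(ρ(ψ_w(X))/√d)^{-τ}] ≤ C_τ`, one has, for `0 ≤ ε₀ ≤ λ < 1` and `q ∈ (0,1)`,
`|R_λ(w) − R_{ε₀}(w)| ≤ 4·osc(f⁰)·(C_τ·λ^{qτ} + exp(−1/(10·λ^{2(1−q)})))`. -/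
theorem statement15 {d : ℕ} (hd : 1 ≤ d) (Y : Finset (EuclideanSpace ℝ (Fin d)))
    (hY : Y.Nonempty)
    {𝒳 : Type*} [MeasurableSpace 𝒳] (μ : Measure 𝒳) [IsProbabilityMeasure μ]
    (ψ : 𝒳 → EuclideanSpace ℝ (Fin d)) (hψ : Measurable ψ)
    (f : EuclideanSpace ℝ (Fin d) → 𝒳 → ℝ) (hfmeas : ∀ y, Measurable (f y))
    (Cf : ℝ) (hfbd : ∀ y x, |f y x| ≤ Cf)
    (oscf : ℝ)
    (hosc : oscf =
        sSup ((fun z : EuclideanSpace ℝ (Fin d) × 𝒳 => f z.1 z.2) ''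
            ((Y : Set (EuclideanSpace ℝ (Fin d))) ×ˢ (Set.univ : Set 𝒳))) -
          sInf ((fun z : EuclideanSpace ℝ (Fin d) × 𝒳 => f z.1 z.2) ''
            ((Y : Set (EuclideanSpace ℝ (Fin d))) ×ˢ (Set.univ : Set 𝒳))))
    (τ C : ℝ) (hτ : 0 < τ)
    (hmom : (∫⁻ x, (ENNReal.ofReal (coneRadius Y (ψ x) / Real.sqrt d)) ^ (-τ) ∂μ) ≤
      ENNReal.ofReal C)
    (R : ℝ → ℝ)
    (hR : ∀ ε : ℝ, R ε =
        ∫ x, ∫ z, (∑ y ∈ Y, p0 Y y (ψ x + ε • z) * f y x)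
          ∂(gaussMeasure d (Real.sqrt d)⁻¹) ∂μ)
    (ε₀ lam q : ℝ) (hε₀ : 0 ≤ ε₀) (hle : ε₀ ≤ lam) (hlam1 : lam < 1)
    (hq : q ∈ Set.Ioo (0 : ℝ) 1) :
    |R lam - R ε₀| ≤
      4 * oscf * (C * lam ^ (q * τ) + Real.exp (-1 / (10 * lam ^ (2 * (1 - q))))) := by
  have hd' : (0 : ℝ) < √d := Real.sqrt_pos.2 (by exact_mod_cast hd)
  have hρ : Measurable fun x => coneRadius Y (ψ x) / √d :=
    ((measurable_coneRadius Y).comp hψ).div_const _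
  have hpos : ∀ᵐ x ∂μ, 0 < coneRadius Y (ψ x) := by
    filter_upwards [ae_pos_of_lintegral_rpow_neg_le hρ hτ hmom] with x hx
    exact (div_pos_iff_of_pos_right hd').1 hx
  obtain ⟨x₀, hx₀⟩ := hpos.exists
  have h2 := exists_ne_of_coneRadius_pos hY hx₀
  have hC := nonneg_of_lintegral_rpow_neg_le hρ hτ hmom
  have hD : ∀ x, ∀ y ∈ Y, ∀ y' ∈ Y, |f y x - f y' x| ≤ oscf := by
    set S := (fun z : EuclideanSpace ℝ (Fin d) × 𝒳 => f z.1 z.2) ''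
      ((Y : Set (EuclideanSpace ℝ (Fin d))) ×ˢ (Set.univ : Set 𝒳))
    have ha : BddAbove S := ⟨Cf, by rintro _ ⟨z, -, rfl⟩; exact (abs_le.1 (hfbd _ _)).2⟩
    have hb : BddBelow S := ⟨-Cf, by rintro _ ⟨z, -, rfl⟩; exact (abs_le.1 (hfbd _ _)).1⟩
    have hm : ∀ x, ∀ y ∈ Y, f y x ∈ S := fun x y hy => ⟨(y, x), ⟨hy, trivial⟩, rfl⟩
    intro x y hy y' hy'
    have e1 := le_csSup ha (hm x y hy)
    have e2 := le_csSup ha (hm x y' hy')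
    have e3 := csInf_le hb (hm x y hy)
    have e4 := csInf_le hb (hm x y' hy')
    rw [hosc, abs_le]
    constructor <;> linarith
  have hD0 : 0 ≤ oscf := by
    obtain ⟨y, hy⟩ := hY
    exact (abs_nonneg _).trans (hD x₀ y hy y hy)
  have hlam0 : 0 ≤ lam := hε₀.trans hle
  rcases hlam0.eq_or_lt with rfl | hlam
  · rw [le_antisymm hle hε₀, sub_self, abs_zero]
    positivity
  set s : Set 𝒳 := {x | coneRadius Y (ψ x) / √d ≤ lam ^ q} with hs_def
  have hs : MeasurableSet s := measurableSet_le hρ measurable_const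
  set T := 2 * Real.exp (-1 / (10 * lam ^ (2 * (1 - q)))) with hT
  have hint : ∀ ε, 0 ≤ ε → Integrable (fun x => perturbedScore Y (fun y => f y x) ε (ψ x)) μ :=
    fun ε hε => integrable_perturbedScore hd h2 hψ hfmeas hfbd hpos hε
  have hbound : |R lam - R ε₀| ≤ ∫ x, 2 * oscf * (s.indicator (fun _ => (1 : ℝ)) x + T) ∂μ := by
    have hRε : ∀ ε, R ε = ∫ x, perturbedScore Y (fun y => f y x) ε (ψ x) ∂μ := hR
    rw [hRε, hRε, ← integral_sub (hint _ hlam0) (hint _ hε₀), ← Real.norm_eq_abs]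
    refine norm_integral_le_of_norm_le
      ((((integrable_const (μ := μ) (1 : ℝ)).indicator hs).add (integrable_const T)).const_mul _)
      ?_
    filter_upwards [hpos] with x hx
    have e1 := abs_perturbedScore_sub_zero_le hd h2 (fun y => hfbd y x) (hD x) hx hlam0 le_rfl
    have e2 := abs_perturbedScore_sub_zero_le hd h2 (fun y => hfbd y x) (hD x) hx hε₀ hle
    have e3 := mul_le_mul_of_nonneg_left
      (gaussMeasure_coneRadius_le (Y := Y) hd (ψ x) hlam hlam1 hq.2) hD0
    have e4 : {η | coneRadius Y η / √d ≤ lam ^ q}.indicator (fun _ => (1 : ℝ)) (ψ x) =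
        s.indicator (fun _ => (1 : ℝ)) x := rfl
    rw [e4, ← hT] at e3
    rw [abs_le] at e1 e2
    rw [Real.norm_eq_abs, abs_le]
    constructor <;> linarith
  have hmarkov : μ.real s ≤ C * lam ^ (q * τ) := by
    rw [Real.rpow_mul hlam0]
    exact measureReal_le_mul_rpow_of_lintegral_rpow_neg_le hρ hτ hC hmom (by positivity)
  have heval : ∫ x, 2 * oscf * (s.indicator (fun _ => (1 : ℝ)) x + T) ∂μ =
      2 * oscf * (μ.real s + T) := by
    rw [integral_const_mul, integral_add ((integrable_const (1 : ℝ)).indicator hs)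
      (integrable_const T), integral_indicator_const _ hs]
    simp
  have hCl : 0 ≤ C * lam ^ (q * τ) := by positivity
  calc |R lam - R ε₀| ≤ 2 * oscf * (μ.real s + T) := hbound.trans_eq heval
    _ ≤ 2 * oscf * (2 * (C * lam ^ (q * τ)) + T) := by gcongr; linarith
    _ = _ := by rw [hT]; ring
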